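/- Let n ≥ 2 and let a_1 < a_2 < ⋯ < a_n be real numbers, and set e_k = e^{2πi a_k} for 1 ≤ k ≤ n and b_k = π(a_k − a_{k−1}) for 2 ≤ k ≤ n. Assume that sin b_k ≠ 0 for all 2 ≤ k ≤ n. Then ∑_{k=1}^n e_k = e_1 · (i e^{−i b_2})/(2 sin b_2) − (i/2) ∑_{k=2}^{n−1} e_k (cot b_k − cot b_{k+1}) − e_n · (i e^{i b_n})/(2 sin b_n). -/

import Mathlib

/-- The half-angle form of the sum of two unit complex numbers: if `w = z e^{2iθ}` then
`z + w = i cot θ (z - w)`. -/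
theorem add_mul_exp_eq_cot_mul_sub (θ : ℝ) (hθ : Real.sin θ ≠ 0) (z w : ℂ)
    (hw : w = z * Complex.exp (2 * (θ * Complex.I))) :
    z + w = Complex.I * (Real.cot θ : ℂ) * (z - w) := by
  have hs : (Real.sin θ : ℂ) ≠ 0 := by exact_mod_cast hθ
  have hsq : (Real.sin θ : ℂ) ^ 2 + (Real.cos θ : ℂ) ^ 2 = 1 := by
    exact_mod_cast Real.sin_sq_add_cos_sq θ
  have hexp : Complex.exp (2 * (θ * Complex.I))
      = ((Real.cos θ : ℂ) + (Real.sin θ : ℂ) * Complex.I) ^ 2 := by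
    rw [two_mul, Complex.exp_add, Complex.exp_mul_I, Complex.ofReal_cos, Complex.ofReal_sin, sq]
  rw [hw, hexp, Real.cot_eq_cos_div_sin, Complex.ofReal_div]
  field_simp
  generalize (Real.sin θ : ℂ) = s at *
  generalize (Real.cos θ : ℂ) = c at *
  linear_combination (-z * (s - Complex.I * c)) * hsq
    + (z * (s ^ 3 + 2 * c ^ 2 * s + Complex.I * c * s ^ 2)) * Complex.I_sq

/-- The exponential boundary term `i e^{-iθ} / (2 sin θ)` in terms of the cotangent. -/
theorem I_mul_exp_neg_div_two_sin (θ : ℝ) (hθ : Real.sin θ ≠ 0) :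
    Complex.I * Complex.exp (-Complex.I * θ) / (2 * (Real.sin θ : ℂ))
      = Complex.I / 2 * (Real.cot θ : ℂ) + 1 / 2 := by
  have hs : (Real.sin θ : ℂ) ≠ 0 := by exact_mod_cast hθ
  have hexp : Complex.exp (-Complex.I * θ)
      = (Real.cos θ : ℂ) - (Real.sin θ : ℂ) * Complex.I := by
    rw [show -Complex.I * θ = (-(θ : ℂ)) * Complex.I by ring, Complex.exp_mul_I,
      Complex.cos_neg, Complex.sin_neg, Complex.ofReal_cos, Complex.ofReal_sin]
    ring
  rw [hexp, Real.cot_eq_cos_div_sin, Complex.ofReal_div]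
  field_simp
  linear_combination (-(Real.sin θ : ℂ)) * Complex.I_sq

/-- The exponential boundary term `i e^{iθ} / (2 sin θ)` in terms of the cotangent. -/
theorem I_mul_exp_div_two_sin (θ : ℝ) (hθ : Real.sin θ ≠ 0) :
    Complex.I * Complex.exp (Complex.I * θ) / (2 * (Real.sin θ : ℂ))
      = Complex.I / 2 * (Real.cot θ : ℂ) - 1 / 2 := by
  have h := I_mul_exp_neg_div_two_sin (-θ) (by simpa using hθ)
  simp only [Real.sin_neg, Complex.ofReal_neg, Real.cot_eq_cos_div_sin, Real.cos_neg,
    mul_neg, neg_mul, neg_neg, div_neg] at h ⊢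
  linear_combination -h

/-- Summation by parts for a sequence with `e k + e (k + 1) = i c (k + 1) (e k - e (k + 1))`. -/
theorem sum_Icc_eq_of_add_eq_mul_sub (e c : ℕ → ℂ) (n : ℕ) (hn : 2 ≤ n)
    (h : ∀ k, 1 ≤ k → k < n →
      e k + e (k + 1) = Complex.I * c (k + 1) * (e k - e (k + 1))) :
    ∑ k ∈ Finset.Icc 1 n, e k
      = e 1 * (Complex.I / 2 * c 2 + 1 / 2)
        - Complex.I / 2 * ∑ k ∈ Finset.Icc 2 (n - 1), e k * (c k - c (k + 1))
        - e n * (Complex.I / 2 * c n - 1 / 2) := by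
  induction n, hn using Nat.le_induction with
  | base =>
    have h1 := h 1 le_rfl (by norm_num)
    norm_num [Finset.sum_Icc_succ_top] at h1 ⊢
    linear_combination h1 / 2
  | succ m hm ih =>
    have hm1 := h m (by omega) (by omega)
    have hsum : ∑ k ∈ Finset.Icc 2 m, e k * (c k - c (k + 1))
        = ∑ k ∈ Finset.Icc 2 (m - 1), e k * (c k - c (k + 1)) + e m * (c m - c (m + 1)) := by
      obtain ⟨l, rfl⟩ : ∃ l, m = l + 1 := ⟨m - 1, by omega⟩
      rw [Finset.sum_Icc_succ_top hm, Nat.add_sub_cancel]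
    rw [Finset.sum_Icc_succ_top (by omega), ih fun k hk hkm => h k hk (by omega),
      Nat.add_sub_cancel, hsum]
    linear_combination hm1 / 2


/-- **Landau's summation identity.** For `n ≥ 2` and reals `a 1 < a 2 < ⋯ < a n`, with
`e k = e^{2πi a k}` and `b k = π (a k - a (k-1))`, assuming `sin (b k) ≠ 0` for
`2 ≤ k ≤ n`, one has
`∑_{k=1}^n e k = e 1 · (i e^{-i b 2})/(2 sin b 2)
  - (i/2) ∑_{k=2}^{n-1} e k (cot b k - cot b (k+1)) - e n · (i e^{i b n})/(2 sin b n)`. -/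
theorem landau_identity (n : ℕ) (hn : 2 ≤ n) (a : ℕ → ℝ)
    (hlt : ∀ k, 1 ≤ k → k < n → a k < a (k + 1))
    (e : ℕ → ℂ) (he : ∀ k, 1 ≤ k → k ≤ n →
      e k = Complex.exp (2 * (Real.pi : ℂ) * Complex.I * (a k : ℂ)))
    (b : ℕ → ℝ) (hb : ∀ k, 2 ≤ k → k ≤ n → b k = Real.pi * (a k - a (k - 1)))
    (hsin : ∀ k, 2 ≤ k → k ≤ n → Real.sin (b k) ≠ 0) :
    ∑ k ∈ Finset.Icc 1 n, e k
      = e 1 * (Complex.I * Complex.exp (-Complex.I * (b 2 : ℂ))) / (2 * (Real.sin (b 2) : ℂ))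
        - Complex.I / 2 * ∑ k ∈ Finset.Icc 2 (n - 1),
            e k * ((Real.cot (b k) : ℂ) - (Real.cot (b (k + 1)) : ℂ))
        - e n * (Complex.I * Complex.exp (Complex.I * (b n : ℂ))) / (2 * (Real.sin (b n) : ℂ)) := by
  rw [mul_div_assoc (e 1), mul_div_assoc (e n), I_mul_exp_neg_div_two_sin _ (hsin 2 le_rfl hn),
    I_mul_exp_div_two_sin _ (hsin n hn le_rfl)]
  refine sum_Icc_eq_of_add_eq_mul_sub e (fun k => (Real.cot (b k) : ℂ)) n hn fun k hk hkn => ?_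
  refine add_mul_exp_eq_cot_mul_sub _ (hsin (k + 1) (by omega) hkn) _ _ ?_
  rw [he k hk hkn.le, he (k + 1) (by omega) hkn, hb (k + 1) (by omega) hkn, ← Complex.exp_add,
    Nat.add_sub_cancel]
  push_cast
  ring_nf
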